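/- arXiv:1606.02682 — 3 statements merged into one kernel-verified Lean document; each statement's English description precedes it below -/
import Mathlib

section
/- Testable implication of Strong Principal Ignorability: assume randomization (Z independent of (X, S, Y0, Y1) with 0 < P(Z = true) < 1), P({Z = true} ∩ {S = true}) > 0, and the treatment-side ignorability condition E[Y1 | σ(S) ⊔ σ(X)] = E[Y1 | σ(X)] P-a.s. Then the direct estimand and the weighted estimand of the High-Taker treatment mean coincide: E[Y | {Z = true} ∩ {S = true}] = E[π · Y | Z = true] / E[π | Z = true], where π := E[1_{S} | σ(X)] and Y := if Z then Y1 else Y0. -/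
open MeasureTheory ProbabilityTheory

/-- Integrating a variable over an event independent of it multiplies its mean by the probability
of the event. -/
lemma setIntegral_eq_of_indep {Ω : Type*} {m₁ m₂ mΩ : MeasurableSpace Ω} {μ : Measure Ω}
    [IsProbabilityMeasure μ] (hle₁ : m₁ ≤ mΩ) (hle₂ : m₂ ≤ mΩ) {f : Ω → ℝ}
    (hf : StronglyMeasurable[m₁] f) (hfint : Integrable f μ) (hindep : Indep m₁ m₂ μ)
    {s : Set Ω} (hs : MeasurableSet[m₂] s) :
    ∫ ω in s, f ω ∂μ = μ.real s * ∫ ω, f ω ∂μ := by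
  rw [← setIntegral_condExp hle₂ hfint hs,
    integral_congr_ae (ae_restrict_of_ae (condExp_indep_eq hle₁ hle₂ hf hindep)),
    setIntegral_const, smul_eq_mul]

/-- Replacing one factor by its conditional expectation does not change the mean of a product
whose other factor is bounded and measurable for the conditioning σ-algebra. -/
lemma integral_mul_condExp_of_bound {Ω : Type*} {m mΩ : MeasurableSpace Ω} {μ : Measure Ω}
    [IsFiniteMeasure μ] (hm : m ≤ mΩ) {f g : Ω → ℝ} (hf : StronglyMeasurable[m] f)
    (hg : Integrable g μ) (c : ℝ) (hbound : ∀ᵐ ω ∂μ, ‖f ω‖ ≤ c) :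
    ∫ ω, f ω * (μ[g | m]) ω ∂μ = ∫ ω, f ω * g ω ∂μ :=
  (integral_congr_ae (condExp_stronglyMeasurable_mul_of_bound hm hf hg c hbound)).symm.trans
    (integral_condExp hm)

/-- Replacing a bounded factor by its conditional expectation does not change the mean of a
product whose other factor is measurable for the conditioning σ-algebra. -/
lemma integral_condExp_mul_of_bound {Ω : Type*} {m mΩ : MeasurableSpace Ω} {μ : Measure Ω}
    [IsFiniteMeasure μ] (hm : m ≤ mΩ) {f g : Ω → ℝ} (hf : Integrable f μ)
    (hg : StronglyMeasurable[m] g) (hgint : Integrable g μ) (c : ℝ)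
    (hbound : ∀ᵐ ω ∂μ, ‖f ω‖ ≤ c) :
    ∫ ω, (μ[f | m]) ω * g ω ∂μ = ∫ ω, f ω * g ω ∂μ :=
  (integral_congr_ae (condExp_mul_of_stronglyMeasurable_right hg
    (hgint.bdd_mul hf.aestronglyMeasurable hbound) hf)).symm.trans (integral_condExp hm)

/-- The mean under a conditioned measure is the normalized integral over the event. -/
lemma integral_cond_eq {Ω : Type*} {mΩ : MeasurableSpace Ω} (μ : Measure Ω) (s : Set Ω)
    (f : Ω → ℝ) : ∫ ω, f ω ∂(μ[|s]) = (μ.real s)⁻¹ * ∫ ω in s, f ω ∂μ := by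
  rw [ProbabilityTheory.cond, integral_smul_measure, ENNReal.toReal_inv, smul_eq_mul,
    measureReal_def]

/-- Testable implication of Strong Principal Ignorability: under the treatment-side
ignorability condition, the direct and weighted estimands of the High-Taker
treatment mean coincide:
`E[Y | Z = 1, S = 1] = E[π·Y | Z = 1] / E[π | Z = 1]`. -/
theorem strong_PI_testable_implication
    {Ω 𝒳 : Type*} {mΩ : MeasurableSpace Ω} {m𝒳 : MeasurableSpace 𝒳}
    (P : Measure Ω) [IsProbabilityMeasure P]
    (X : Ω → 𝒳) (S Z : Ω → Bool) (Y0 Y1 : Ω → ℝ)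
    (hX : Measurable X) (hS : Measurable S) (hZ : Measurable Z)
    (hY0m : Measurable Y0) (hY1m : Measurable Y1)
    (hY0 : Integrable Y0 P) (hY1 : Integrable Y1 P)
    (hindep : IndepFun Z (fun ω => (X ω, S ω, Y0 ω, Y1 ω)) P)
    (hZpos : 0 < P {ω | Z ω = true}) (hZlt : P {ω | Z ω = true} < 1)
    (hZSpos : 0 < P ({ω | Z ω = true} ∩ {ω | S ω = true}))
    (hPI1 : P[Y1 | MeasurableSpace.comap S inferInstance ⊔ MeasurableSpace.comap X m𝒳]
        =ᵐ[P] P[Y1 | MeasurableSpace.comap X m𝒳]) :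
    (∫ ω, (if Z ω then Y1 ω else Y0 ω) ∂(P[|{ω | Z ω = true} ∩ {ω | S ω = true}]))
      = (∫ ω, (P[(fun ω' => if S ω' then (1 : ℝ) else 0) | MeasurableSpace.comap X m𝒳]) ω
            * (if Z ω then Y1 ω else Y0 ω) ∂(P[|{ω | Z ω = true}]))
        / (∫ ω, (P[(fun ω' => if S ω' then (1 : ℝ) else 0) | MeasurableSpace.comap X m𝒳]) ω
            ∂(P[|{ω | Z ω = true}])) := by
  set mX := MeasurableSpace.comap X m𝒳
  set mSX := MeasurableSpace.comap S inferInstance ⊔ mX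
  set W : Ω → 𝒳 × Bool × ℝ × ℝ := fun ω => (X ω, S ω, Y0 ω, Y1 ω)
  set mW := MeasurableSpace.comap W inferInstance
  set mZ := MeasurableSpace.comap Z inferInstance
  set A : Set Ω := {ω | Z ω = true}
  set B : Set Ω := {ω | S ω = true}
  set s : Ω → ℝ := fun ω => if S ω then (1 : ℝ) else 0
  set π : Ω → ℝ := P[s | mX]
  have hWm : Measurable[mΩ] W := hX.prodMk (hS.prodMk (hY0m.prodMk hY1m))
  have hmX : mX ≤ mΩ := hX.comap_le
  have hmSX : mSX ≤ mΩ := sup_le hS.comap_le hmX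
  have hmW : mW ≤ mΩ := hWm.comap_le
  have hWW : Measurable[mW] W := comap_measurable W
  have hXW : Measurable[mW] X := measurable_fst.comp hWW
  have hSW : Measurable[mW] S := (measurable_fst.comp measurable_snd).comp hWW
  have hYW : Measurable[mW] Y1 :=
    (measurable_snd.comp (measurable_snd.comp measurable_snd)).comp hWW
  have hite : Measurable fun b : Bool => if b then (1 : ℝ) else 0 := measurable_of_finite _
  have hsW : Measurable[mW] s := hite.comp hSW
  have hsSX : StronglyMeasurable[mSX] s :=
    (hite.comp ((comap_measurable S).mono (show _ ≤ mSX from le_sup_left)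
      le_rfl)).stronglyMeasurable
  have hπX : StronglyMeasurable[mX] π := stronglyMeasurable_condExp
  have hπW : Measurable[mW] π := (hπX.mono hXW.comap_le).measurable
  have hA : MeasurableSet[mZ] A := comap_measurable Z (measurableSet_singleton true)
  have hA' : MeasurableSet[mΩ] A := hZ.comap_le A hA
  have hB : MeasurableSet[mΩ] B := hS (measurableSet_singleton true)
  have hs_bound : ∀ᵐ ω ∂P, ‖s ω‖ ≤ 1 := by
    refine .of_forall fun ω => ?_
    by_cases h : S ω <;> simp [s, h]
  have hπ_bound : ∀ᵐ ω ∂P, ‖π ω‖ ≤ 1 := 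
    ae_bdd_abs_condExp_of_ae_bdd_abs hs_bound
  have hs_int : Integrable s P :=
    .of_bound (hsW.mono hmW le_rfl).aestronglyMeasurable 1 hs_bound
  have hsY_int : Integrable (fun ω => s ω * Y1 ω) P :=
    hY1.bdd_mul hs_int.aestronglyMeasurable hs_bound
  have hπY_int : Integrable (fun ω => π ω * Y1 ω) P :=
    hY1.bdd_mul integrable_condExp.aestronglyMeasurable hπ_bound
  have hWZ : Indep mW mZ P := ((IndepFun_iff_Indep _ _ _).1 hindep).symm
  have hfactor : ∀ f : Ω → ℝ, Measurable[mW] f → Integrable f P →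
      ∫ ω in A, f ω ∂P = P.real A * ∫ ω, f ω ∂P := fun f hf hfi =>
    setIntegral_eq_of_indep hmW hZ.comap_le hf.stronglyMeasurable hfi hWZ hA
  have hrestrict : ∀ f : Ω → ℝ, ∫ ω in A, s ω * f ω ∂P = ∫ ω in A ∩ B, f ω ∂P := by
    intro f
    rw [← setIntegral_indicator hB]
    congr with ω
    by_cases h : S ω <;> simp [s, B, h]
  have hmean : ∫ ω, s ω * Y1 ω ∂P = ∫ ω, π ω * Y1 ω ∂P := by
    rw [← integral_mul_condExp_of_bound hmSX hsSX hY1 1 hs_bound,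
      ← integral_mul_condExp_of_bound hmX hπX hY1 1 hπ_bound,
      integral_condExp_mul_of_bound hmX hs_int stronglyMeasurable_condExp integrable_condExp 1
        hs_bound]
    refine integral_congr_ae ?_
    filter_upwards [hPI1] with ω hω
    rw [hω]
  have hAB : P.real (A ∩ B) = P.real A * ∫ ω, s ω ∂P := by
    rw [← hfactor s hsW hs_int]
    simpa using (hrestrict fun _ => 1).symm
  have hA0 : P.real A ≠ 0 := (ENNReal.toReal_pos hZpos.ne' (measure_ne_top _ _)).ne'
  have hleft : ∫ ω in A ∩ B, (if Z ω then Y1 ω else Y0 ω) ∂P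
      = P.real A * ∫ ω, s ω * Y1 ω ∂P := by
    rw [← hfactor (fun ω => s ω * Y1 ω) (hsW.mul hYW) hsY_int, hrestrict]
    exact setIntegral_congr_fun (hA'.inter hB) fun ω hω => if_pos hω.1
  have hright : ∫ ω in A, π ω * (if Z ω then Y1 ω else Y0 ω) ∂P
      = P.real A * ∫ ω, π ω * Y1 ω ∂P := by
    rw [← hfactor (fun ω => π ω * Y1 ω) (hπW.mul hYW) hπY_int]
    exact setIntegral_congr_fun hA' fun ω hω => congrArg (π ω * ·) (if_pos hω)
  rw [integral_cond_eq, integral_cond_eq, integral_cond_eq, hleft, hright,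
    hfactor π hπW integrable_condExp, integral_condExp hmX, hAB, hmean,
    inv_mul_cancel_left₀ hA0, inv_mul_cancel_left₀ hA0, mul_inv, mul_comm (P.real A)⁻¹,
    mul_assoc, inv_mul_cancel_left₀ hA0, div_eq_inv_mul]
end

section
/- Identification of the Complier control mean under the exclusion restriction for Never Takers: assume randomization (Z independent of (X, D0, D1, Y0, Y1) with 0 < P(Z = true) < 1), monotonicity (D0 ≤ D1 pointwise), the exclusion restriction for Never Takers E[Y0 | D1 = false] = E[Y1 | D1 = false] (with P(D1 = false) possibly zero, in which case the term vanishes), and positivity P(D0 = false, D1 = true) > 0. Then, with observed D := if Z then D1 else D0 and Y := if Z then Y1 else Y0, E[Y0 | {D0 = false} ∩ {D1 = true}] = ( (π_c + π_n) · E[Y | {Z = false} ∩ {D = false}] − π_n · E[Y | {Z = true} ∩ {D = false}] ) / π_c, where π_c := P(D0 = false, D1 = true), π_n := P(D1 = false), and the conditioning events on the right-hand side have positive probability. -/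
open MeasureTheory ProbabilityTheory

/-- The conditional mean given `s`, weighted by the probability of `s`, is the set integral
over `s`; this holds for null sets too. -/
theorem measureReal_mul_integral_cond {Ω : Type*} {mΩ : MeasurableSpace Ω}
    (P : Measure Ω) [IsFiniteMeasure P] (s : Set Ω) (f : Ω → ℝ) :
    (P s).toReal * ∫ ω, f ω ∂(P[|s]) = ∫ ω in s, f ω ∂P := by
  rw [ProbabilityTheory.cond, integral_smul_measure, smul_eq_mul, ENNReal.toReal_inv]
  by_cases h : P s = 0
  · simp [h, Measure.restrict_eq_zero.2 h]
  · rw [mul_inv_cancel_left₀ (ENNReal.toReal_ne_zero.2 ⟨h, measure_ne_top P s⟩)]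

/-- Conditioning further on an event that depends only on an independent variable does not
change a conditional mean. -/
theorem integral_cond_inter_of_indepFun {Ω α β : Type*} {mΩ : MeasurableSpace Ω}
    {mα : MeasurableSpace α} {mβ : MeasurableSpace β}
    (P : Measure Ω) [IsFiniteMeasure P] {Z : Ω → α} {W : Ω → β}
    (hZ : Measurable Z) (hW : Measurable W) (h : IndepFun Z W P)
    {A : Set α} (hA : MeasurableSet A) {S : Set β} (hS : MeasurableSet S)
    {φ : β → ℝ} (hφ : Measurable φ) (hpos : P (Z ⁻¹' A) ≠ 0) :
    ∫ ω, φ (W ω) ∂(P[|Z ⁻¹' A ∩ W ⁻¹' S]) = ∫ ω, φ (W ω) ∂(P[|W ⁻¹' S]) := by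
  have hm : P (Z ⁻¹' A ∩ W ⁻¹' S) = P (Z ⁻¹' A) * P (W ⁻¹' S) :=
    h.measure_inter_preimage_eq_mul A S hA hS
  have hi : ∫ ω in Z ⁻¹' A ∩ W ⁻¹' S, φ (W ω) ∂P
      = (P (Z ⁻¹' A)).toReal * ∫ ω in W ⁻¹' S, φ (W ω) ∂P := by
    have hind : IndepFun (fun ω => A.indicator (fun _ => (1 : ℝ)) (Z ω))
        (fun ω => S.indicator φ (W ω)) P :=
      h.comp (measurable_const.indicator hA) (hφ.indicator hS)
    have hmul := hind.integral_fun_mul_eq_mul_integral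
      ((measurable_const.indicator hA).comp hZ).aestronglyMeasurable
      ((hφ.indicator hS).comp hW).aestronglyMeasurable
    have hone : ∫ ω, A.indicator (fun _ => (1 : ℝ)) (Z ω) ∂P = (P (Z ⁻¹' A)).toReal := by
      rw [← Measure.real_def, ← integral_indicator_one (hZ hA)]
      rfl
    rw [← integral_indicator ((hZ hA).inter (hW hS)), ← integral_indicator (hW hS), ← hone]
    refine Eq.trans (integral_congr_ae (ae_of_all _ fun ω => ?_)) hmul
    by_cases hz : Z ω ∈ A <;> by_cases hw : W ω ∈ S <;> simp [hz, hw]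
  rw [ProbabilityTheory.cond, ProbabilityTheory.cond, integral_smul_measure,
    integral_smul_measure, hi, hm, smul_eq_mul, smul_eq_mul, ENNReal.toReal_inv,
    ENNReal.toReal_inv, ENNReal.toReal_mul]
  have : (P (Z ⁻¹' A)).toReal ≠ 0 := ENNReal.toReal_ne_zero.2 ⟨hpos, measure_ne_top _ _⟩
  rw [mul_inv, mul_comm (P (Z ⁻¹' A)).toReal⁻¹, mul_assoc, inv_mul_cancel_left₀ this]

/-- Identification of the Complier control mean under the exclusion restriction for
Never Takers: `E[Y0 | Complier]
 = ((π_c + π_n)·E[Y | Z = false, D = false] − π_n·E[Y | Z = true, D = false]) / π_c`. -/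
theorem complier_control_mean_exclusion_restriction
    {Ω 𝒳 : Type*} {mΩ : MeasurableSpace Ω} {m𝒳 : MeasurableSpace 𝒳}
    (P : Measure Ω) [IsProbabilityMeasure P]
    (X : Ω → 𝒳) (D0 D1 Z : Ω → Bool) (Y0 Y1 : Ω → ℝ)
    (hX : Measurable X) (hD0 : Measurable D0) (hD1 : Measurable D1)
    (hZ : Measurable Z) (hY0m : Measurable Y0) (hY1m : Measurable Y1)
    (hY0 : Integrable Y0 P) (hY1 : Integrable Y1 P)
    (hindep : IndepFun Z (fun ω => (X ω, D0 ω, D1 ω, Y0 ω, Y1 ω)) P)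
    (hZpos : 0 < P {ω | Z ω = true}) (hZlt : P {ω | Z ω = true} < 1)
    (hmono : ∀ ω, D0 ω = true → D1 ω = true)
    (hexcl : (∫ ω, Y0 ω ∂(P[|{ω | D1 ω = false}]))
        = ∫ ω, Y1 ω ∂(P[|{ω | D1 ω = false}]))
    (hcpos : 0 < P {ω | D0 ω = false ∧ D1 ω = true}) :
    (∫ ω, Y0 ω ∂(P[|{ω | D0 ω = false} ∩ {ω | D1 ω = true}]))
      = (((P {ω | D0 ω = false ∧ D1 ω = true}).toReal + (P {ω | D1 ω = false}).toReal)
            * (∫ ω, (if Z ω then Y1 ω else Y0 ω)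
                ∂(P[|{ω | Z ω = false} ∩ {ω | (if Z ω then D1 ω else D0 ω) = false}]))
          - (P {ω | D1 ω = false}).toReal
            * (∫ ω, (if Z ω then Y1 ω else Y0 ω)
                ∂(P[|{ω | Z ω = true} ∩ {ω | (if Z ω then D1 ω else D0 ω) = false}])))
        / (P {ω | D0 ω = false ∧ D1 ω = true}).toReal := by
  have hW : Measurable (fun ω => (X ω, D0 ω, D1 ω, Y0 ω, Y1 ω)) := by fun_prop
  have hZf : P {ω | Z ω = false} ≠ 0 := by
    intro h0
    have hc : {ω | Z ω = false} = {ω | Z ω = true}ᶜ := by ext ω; simp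
    rw [hc] at h0
    exact hZlt.ne ((prob_compl_eq_zero_iff (hZ (measurableSet_singleton true))).1 h0)
  have hcm : MeasurableSet {ω | D0 ω = false ∧ D1 ω = true} :=
    (hD0 (measurableSet_singleton false)).inter (hD1 (measurableSet_singleton true))
  have hnm : MeasurableSet {ω | D1 ω = false} := hD1 (measurableSet_singleton false)
  have hmean0 : ∫ ω, (if Z ω then Y1 ω else Y0 ω)
        ∂(P[|{ω | Z ω = false} ∩ {ω | (if Z ω then D1 ω else D0 ω) = false}])
      = ∫ ω, Y0 ω ∂(P[|{ω | D0 ω = false}]) := by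
    have hset : {ω | Z ω = false} ∩ {ω | (if Z ω then D1 ω else D0 ω) = false}
        = {ω | Z ω = false} ∩ {ω | D0 ω = false} := by
      ext ω; cases h : Z ω <;> simp [h]
    have hm : MeasurableSet ({ω | Z ω = false} ∩ {ω | D0 ω = false}) :=
      (hZ (measurableSet_singleton false)).inter (hD0 (measurableSet_singleton false))
    rw [hset]
    refine Eq.trans (integral_congr_ae ?_)
      (integral_cond_inter_of_indepFun P hZ hW hindep (measurableSet_singleton false)
        (S := {w | w.2.1 = false}) (φ := fun w => w.2.2.2.1)
        (measurableSet_eq_fun (by fun_prop) measurable_const) (by fun_prop) hZf)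
    filter_upwards [ae_cond_mem hm] with ω hω
    have hz : Z ω = false := hω.1
    simp [hz]
  have hmean1 : ∫ ω, (if Z ω then Y1 ω else Y0 ω)
        ∂(P[|{ω | Z ω = true} ∩ {ω | (if Z ω then D1 ω else D0 ω) = false}])
      = ∫ ω, Y1 ω ∂(P[|{ω | D1 ω = false}]) := by
    have hset : {ω | Z ω = true} ∩ {ω | (if Z ω then D1 ω else D0 ω) = false}
        = {ω | Z ω = true} ∩ {ω | D1 ω = false} := by
      ext ω; cases h : Z ω <;> simp [h]
    have hm : MeasurableSet ({ω | Z ω = true} ∩ {ω | D1 ω = false}) :=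
      (hZ (measurableSet_singleton true)).inter hnm
    rw [hset]
    refine Eq.trans (integral_congr_ae ?_)
      (integral_cond_inter_of_indepFun P hZ hW hindep (measurableSet_singleton true)
        (S := {w | w.2.2.1 = false}) (φ := fun w => w.2.2.2.2)
        (measurableSet_eq_fun (by fun_prop) measurable_const) (by fun_prop) hZpos.ne')
    filter_upwards [ae_cond_mem hm] with ω hω
    have hz : Z ω = true := hω.1
    simp [hz]
  have hunion : {ω | D0 ω = false} = {ω | D0 ω = false ∧ D1 ω = true} ∪ {ω | D1 ω = false} := by
    ext ω
    have := hmono ω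
    cases h0 : D0 ω <;> cases h1 : D1 ω <;> simp_all
  have hdisj : Disjoint {ω | D0 ω = false ∧ D1 ω = true} {ω | D1 ω = false} :=
    Set.disjoint_left.2 fun ω hc hn => Bool.false_ne_true (hn.symm.trans hc.2)
  have hprob : (P {ω | D0 ω = false}).toReal
      = (P {ω | D0 ω = false ∧ D1 ω = true}).toReal + (P {ω | D1 ω = false}).toReal := by
    rw [hunion, measure_union hdisj hnm,
      ENNReal.toReal_add (measure_ne_top _ _) (measure_ne_top _ _)]
  have hsplit : ∫ ω in {ω | D0 ω = false}, Y0 ω ∂P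
      = ∫ ω in {ω | D0 ω = false ∧ D1 ω = true}, Y0 ω ∂P
        + ∫ ω in {ω | D1 ω = false}, Y0 ω ∂P := by
    rw [hunion, setIntegral_union hdisj hnm hY0.integrableOn hY0.integrableOn]
  rw [hmean0, hmean1, ← hexcl, ← hprob, measureReal_mul_integral_cond,
    measureReal_mul_integral_cond, hsplit, add_sub_cancel_right,
    eq_div_iff (ENNReal.toReal_ne_zero.2 ⟨hcpos.ne', measure_ne_top _ _⟩), mul_comm]
  exact measureReal_mul_integral_cond P {ω | D0 ω = false ∧ D1 ω = true} Y0
end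

section
/- Identification of the Complier treatment mean by principal-score weighting under Weak Principal Ignorability on the treatment side: assume monotonicity (D0 ≤ D1 pointwise), P(D0 = false, D1 = true) > 0, and the weak ignorability condition that E[Y1 | σ(X) ⊔ σ(D0) ⊔ σ(D1)] = E[Y1 | σ(X) ⊔ σ(D1)] holds P-almost surely on the event {D1 = true}. Define π_a := E[1_{D0 = true} | σ(X)], π_c := E[1_{D0 = false, D1 = true} | σ(X)], and φ := π_c / (π_c + π_a) (with an arbitrary value where the denominator vanishes). Then E[φ · Y1 · 1_{D1 = true}] = E[Y1 · 1_{D0 = false, D1 = true}] and E[φ · 1_{D1 = true}] = P(D0 = false, D1 = true); in particular E[Y1 | {D0 = false} ∩ {D1 = true}] = E[φ · Y1 · 1_{D1 = true}] / E[φ · 1_{D1 = true}]. -/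
open MeasureTheory ProbabilityTheory

/-- Every event of `σ(X) ⊔ σ(D)` agrees on `{D = true}` with an event of `σ(X)`. -/
theorem exists_measurableSet_comap_iff_of_sup_comap_bool
    {Ω 𝒳 : Type*} {m𝒳 : MeasurableSpace 𝒳} {X : Ω → 𝒳} {D : Ω → Bool} {A : Set Ω}
    (hA : MeasurableSet[MeasurableSpace.comap X m𝒳 ⊔ MeasurableSpace.comap D inferInstance] A) :
    ∃ B, MeasurableSet[MeasurableSpace.comap X m𝒳] B ∧
      ∀ ω, D ω = true → (ω ∈ A ↔ ω ∈ B) := by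
  rw [← MeasurableSpace.comap_prodMk] at hA
  obtain ⟨S, hS, rfl⟩ := hA
  refine ⟨X ⁻¹' {x | (x, true) ∈ S}, ⟨_, measurable_prodMk_right hS, rfl⟩, fun ω hω => ?_⟩
  simp [hω]

/-- If `f` vanishes off `{D = true}` and `h` is a `σ(X)`-measurable version of the ratio
`E[f | X] / P(D = true | X)`, then `E[f | X, D] = h · 1_{D = true}`. -/
theorem condExp_sup_comap_bool_of_mul_condExp
    {Ω 𝒳 : Type*} {mΩ : MeasurableSpace Ω} {m𝒳 : MeasurableSpace 𝒳}
    {P : Measure Ω} [IsFiniteMeasure P]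
    {X : Ω → 𝒳} {D : Ω → Bool} (hX : Measurable X) (hD : Measurable D) {f h : Ω → ℝ}
    (hf : Integrable f P) (hf0 : ∀ ω, D ω = false → f ω = 0)
    (hh : StronglyMeasurable[MeasurableSpace.comap X m𝒳] h)
    (hhD : Integrable (fun ω => h ω * if D ω then (1 : ℝ) else 0) P)
    (heq : ∀ᵐ ω ∂P, h ω *
        (P[(fun ω => if D ω then (1 : ℝ) else 0) | MeasurableSpace.comap X m𝒳]) ω
      = (P[f | MeasurableSpace.comap X m𝒳]) ω) :
    (fun ω => h ω * if D ω then (1 : ℝ) else 0) =ᵐ[P]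
      P[f | MeasurableSpace.comap X m𝒳 ⊔ MeasurableSpace.comap D inferInstance] := by
  have hm0 : MeasurableSpace.comap X m𝒳 ≤ mΩ := hX.comap_le
  have hm1 : MeasurableSpace.comap X m𝒳 ⊔ MeasurableSpace.comap D inferInstance ≤ mΩ :=
    sup_le hm0 hD.comap_le
  have hDint : Integrable (fun ω => if D ω then (1 : ℝ) else 0) P :=
    Integrable.of_bound ((Measurable.ite (hD (measurableSet_singleton true))
      measurable_const measurable_const).aestronglyMeasurable) 1
      (Filter.Eventually.of_forall fun ω => by cases D ω <;> simp)
  refine ae_eq_condExp_of_forall_setIntegral_eq hm1 hf (fun s _ _ => hhD.integrableOn) ?_ ?_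
  · intro A hA _
    obtain ⟨B, hB, hAB⟩ := exists_measurableSet_comap_iff_of_sup_comap_bool hA
    have transfer : ∀ g : Ω → ℝ, (∀ ω, D ω = false → g ω = 0) →
        ∫ ω in A, g ω ∂P = ∫ ω in B, g ω ∂P := by
      intro g hg
      rw [← integral_indicator (hm1 A hA), ← integral_indicator (hm0 B hB)]
      congr 1
      ext ω
      cases hω : D ω
      · simp [Set.indicator, hg ω hω]
      · by_cases hB : ω ∈ B <;> simp [Set.indicator, hAB ω hω, hB]
    rw [transfer _ (fun ω hω => by simp [hω]), transfer f hf0,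
      ← setIntegral_condExp hm0 hhD hB, ← setIntegral_condExp hm0 hf hB]
    refine integral_congr_ae (ae_restrict_of_ae ?_)
    filter_upwards [condExp_mul_of_stronglyMeasurable_left hh hhD hDint, heq] with ω h1 h2
    exact h1.trans h2
  · refine (StronglyMeasurable.mul (hh.mono (le_sup_left
      (b := MeasurableSpace.comap D inferInstance))) ?_).aestronglyMeasurable
    refine Measurable.stronglyMeasurable ?_
    exact Measurable.ite (le_sup_right (a := MeasurableSpace.comap X m𝒳) _
      ⟨{true}, measurableSet_singleton true, rfl⟩) measurable_const measurable_const

/-- The conditional expectation is self-adjoint against a bounded factor. -/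
theorem integral_condExp_mul_eq_integral_mul_condExp
    {Ω : Type*} {m mΩ : MeasurableSpace Ω} {P : Measure Ω} [IsFiniteMeasure P]
    (hm : m ≤ mΩ) {f g : Ω → ℝ} (hf : Integrable f P) (hg : Integrable g P) {C : ℝ}
    (hgC : ∀ᵐ ω ∂P, ‖g ω‖ ≤ C) (hgC' : ∀ᵐ ω ∂P, ‖(P[g | m]) ω‖ ≤ C) :
    ∫ ω, (P[f | m]) ω * g ω ∂P = ∫ ω, f ω * (P[g | m]) ω ∂P := by
  have h1 : Integrable (P[f | m] * g) P :=
    integrable_condExp.mul_bdd hg.aestronglyMeasurable hgC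
  have h2 : Integrable (f * P[g | m]) P :=
    hf.mul_bdd integrable_condExp.aestronglyMeasurable hgC'
  calc ∫ ω, (P[f | m]) ω * g ω ∂P = ∫ ω, (P[P[f | m] * g | m]) ω ∂P :=
        (integral_condExp hm).symm
    _ = ∫ ω, (P[f * P[g | m] | m]) ω ∂P := by
        refine integral_congr_ae ?_
        exact (condExp_mul_of_stronglyMeasurable_left stronglyMeasurable_condExp h1 hg).trans
          (condExp_mul_of_stronglyMeasurable_right stronglyMeasurable_condExp h2 hf).symm
    _ = ∫ ω, f ω * (P[g | m]) ω ∂P := integral_condExp hm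

/-- Identification of the Complier treatment mean by principal-score weighting under
Weak Principal Ignorability on the treatment side, with `φ := π_c / (π_c + π_a)`:
`E[φ·Y1·1_{D1}] = E[Y1·1_{Complier}]`, `E[φ·1_{D1}] = P(Complier)`, and
`E[Y1 | Complier] = E[φ·Y1·1_{D1}] / E[φ·1_{D1}]`. -/
theorem complier_treatment_mean_weighting_weak_PI
    {Ω 𝒳 : Type*} {mΩ : MeasurableSpace Ω} {m𝒳 : MeasurableSpace 𝒳}
    (P : Measure Ω) [IsProbabilityMeasure P]
    (X : Ω → 𝒳) (D0 D1 : Ω → Bool) (Y1 : Ω → ℝ)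
    (hX : Measurable X) (hD0 : Measurable D0) (hD1 : Measurable D1)
    (hY1m : Measurable Y1) (hY1 : Integrable Y1 P)
    (hmono : ∀ ω, D0 ω = true → D1 ω = true)
    (hcpos : 0 < P {ω | D0 ω = false ∧ D1 ω = true})
    (hWPI : ∀ᵐ ω ∂P, D1 ω = true →
      (P[Y1 | MeasurableSpace.comap X m𝒳 ⊔ MeasurableSpace.comap D0 inferInstance
            ⊔ MeasurableSpace.comap D1 inferInstance]) ω
        = (P[Y1 | MeasurableSpace.comap X m𝒳 ⊔ MeasurableSpace.comap D1 inferInstance]) ω) :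
    let π_a := P[(fun ω => if D0 ω then (1 : ℝ) else 0) | MeasurableSpace.comap X m𝒳]
    let π_c := P[(fun ω => if D0 ω = false ∧ D1 ω = true then (1 : ℝ) else 0) |
        MeasurableSpace.comap X m𝒳]
    let φ := fun ω => π_c ω / (π_c ω + π_a ω)
    (∫ ω, φ ω * Y1 ω * (if D1 ω then (1 : ℝ) else 0) ∂P)
        = ∫ ω, Y1 ω * (if D0 ω = false ∧ D1 ω = true then (1 : ℝ) else 0) ∂P
      ∧ (∫ ω, φ ω * (if D1 ω then (1 : ℝ) else 0) ∂P)
        = (P {ω | D0 ω = false ∧ D1 ω = true}).toReal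
      ∧ (∫ ω, Y1 ω ∂(P[|{ω | D0 ω = false} ∩ {ω | D1 ω = true}]))
        = (∫ ω, φ ω * Y1 ω * (if D1 ω then (1 : ℝ) else 0) ∂P)
          / (∫ ω, φ ω * (if D1 ω then (1 : ℝ) else 0) ∂P) := by
  intro π_a π_c φ
  have hm0 : MeasurableSpace.comap X m𝒳 ≤ mΩ := hX.comap_le
  have hm1 : MeasurableSpace.comap X m𝒳 ⊔ MeasurableSpace.comap D1 inferInstance ≤ mΩ :=
    sup_le hm0 hD1.comap_le
  have hm2 : MeasurableSpace.comap X m𝒳 ⊔ MeasurableSpace.comap D0 inferInstance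
      ⊔ MeasurableSpace.comap D1 inferInstance ≤ mΩ :=
    sup_le (sup_le hm0 hD0.comap_le) hD1.comap_le
  have hC2 : MeasurableSet[MeasurableSpace.comap X m𝒳 ⊔ MeasurableSpace.comap D0 inferInstance
      ⊔ MeasurableSpace.comap D1 inferInstance] {ω | D0 ω = false ∧ D1 ω = true} :=
    MeasurableSet.inter
      ((le_sup_right (a := MeasurableSpace.comap X m𝒳)).trans
        (le_sup_left (b := MeasurableSpace.comap D1 inferInstance)) _
        ⟨{false}, measurableSet_singleton false, rfl⟩)
      (le_sup_right (a := MeasurableSpace.comap X m𝒳 ⊔ MeasurableSpace.comap D0 inferInstance) _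
        ⟨{true}, measurableSet_singleton true, rfl⟩)
  have hC : MeasurableSet {ω | D0 ω = false ∧ D1 ω = true} := hm2 _ hC2
  set Ic : Ω → ℝ := fun ω => if D0 ω = false ∧ D1 ω = true then (1 : ℝ) else 0 with hIc
  set Ia : Ω → ℝ := fun ω => if D0 ω then (1 : ℝ) else 0 with hIa
  have hIc_ind : Ic = {ω | D0 ω = false ∧ D1 ω = true}.indicator 1 := by
    ext ω; simp [hIc, Set.indicator]
  have hIc_le : ∀ ω, ‖Ic ω‖ ≤ 1 := fun ω => by simp only [hIc]; split_ifs <;> simp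
  have hIc_int : Integrable Ic P :=
    Integrable.of_bound ((Measurable.ite hC measurable_const
      measurable_const).aestronglyMeasurable) 1 (Filter.Eventually.of_forall hIc_le)
  have hIa_int : Integrable Ia P :=
    Integrable.of_bound ((Measurable.ite (hD0 (measurableSet_singleton true)) measurable_const
      measurable_const).aestronglyMeasurable) 1
      (Filter.Eventually.of_forall fun ω => by simp only [hIa]; split_ifs <;> simp)
  have hsum : (fun ω => if D1 ω then (1 : ℝ) else 0) = Ic + Ia := by
    ext ω
    have := hmono ω
    cases h0 : D0 ω <;> cases h1 : D1 ω <;> simp_all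
  have hc0 : 0 ≤ᵐ[P] π_c := condExp_nonneg (Filter.Eventually.of_forall fun ω => by
    dsimp only; split_ifs <;> simp)
  have ha0 : 0 ≤ᵐ[P] π_a := condExp_nonneg (Filter.Eventually.of_forall fun ω => by
    dsimp only; split_ifs <;> simp)
  have hφm : StronglyMeasurable[MeasurableSpace.comap X m𝒳] φ :=
    (stronglyMeasurable_condExp.measurable.div (stronglyMeasurable_condExp.measurable.add
      stronglyMeasurable_condExp.measurable)).stronglyMeasurable
  have hφD_le : ∀ᵐ ω ∂P, ‖φ ω * if D1 ω then (1 : ℝ) else 0‖ ≤ 1 := by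
    filter_upwards [hc0, ha0] with ω h1 h2
    have h1 : 0 ≤ π_c ω := h1
    have h2 : 0 ≤ π_a ω := h2
    have h3 : |φ ω| ≤ 1 := by
      rw [abs_of_nonneg (div_nonneg h1 (add_nonneg h1 h2))]
      exact div_le_one_of_le₀ (by linarith) (by linarith)
    cases D1 ω
    · simp
    · simpa using h3
  have hφD_int : Integrable (fun ω => φ ω * if D1 ω then (1 : ℝ) else 0) P :=
    Integrable.of_bound ((hφm.mono hm0).measurable.mul
      (Measurable.ite (hD1 (measurableSet_singleton true)) measurable_const
        measurable_const)).aestronglyMeasurable 1 hφD_le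
  have hweight : (fun ω => φ ω * if D1 ω then (1 : ℝ) else 0) =ᵐ[P]
      P[Ic | MeasurableSpace.comap X m𝒳 ⊔ MeasurableSpace.comap D1 inferInstance] := by
    refine condExp_sup_comap_bool_of_mul_condExp hX hD1 hIc_int
      (fun ω hω => by simp [hIc, hω]) hφm hφD_int ?_
    rw [hsum]
    filter_upwards [condExp_add hIc_int hIa_int (MeasurableSpace.comap X m𝒳), hc0, ha0]
      with ω h1 h2 h3
    have h2 : 0 ≤ π_c ω := h2
    have h3 : 0 ≤ π_a ω := h3
    rw [h1]
    change π_c ω / (π_c ω + π_a ω) * (π_c ω + π_a ω) = π_c ω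
    exact div_mul_cancel_of_imp fun h => by linarith
  have hmean : (∫ ω, φ ω * Y1 ω * (if D1 ω then (1 : ℝ) else 0) ∂P)
      = ∫ ω, Y1 ω * Ic ω ∂P := by
    have hIc2 : P[Ic | MeasurableSpace.comap X m𝒳 ⊔ MeasurableSpace.comap D0 inferInstance
        ⊔ MeasurableSpace.comap D1 inferInstance] = Ic :=
      condExp_of_stronglyMeasurable hm2
        (Measurable.ite hC2 measurable_const measurable_const).stronglyMeasurable hIc_int
    calc (∫ ω, φ ω * Y1 ω * (if D1 ω then (1 : ℝ) else 0) ∂P)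
        = ∫ ω, Y1 ω * (P[Ic | MeasurableSpace.comap X m𝒳 ⊔
            MeasurableSpace.comap D1 inferInstance]) ω ∂P := by
          refine integral_congr_ae ?_
          filter_upwards [hweight] with ω h
          rw [← h]; ring
      _ = ∫ ω, (P[Y1 | MeasurableSpace.comap X m𝒳 ⊔
            MeasurableSpace.comap D1 inferInstance]) ω * Ic ω ∂P := by
          refine (integral_condExp_mul_eq_integral_mul_condExp hm1 hY1 hIc_int
            (Filter.Eventually.of_forall hIc_le) ?_).symm
          filter_upwards [hweight, hφD_le] with ω h h'
          rwa [← h]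
      _ = ∫ ω, (P[Y1 | MeasurableSpace.comap X m𝒳 ⊔ MeasurableSpace.comap D0 inferInstance
            ⊔ MeasurableSpace.comap D1 inferInstance]) ω * Ic ω ∂P := by
          refine integral_congr_ae ?_
          filter_upwards [hWPI] with ω h
          cases hω : D1 ω
          · simp [hIc, hω]
          · simp only [h hω]
      _ = ∫ ω, Y1 ω * Ic ω ∂P := by
          rw [integral_condExp_mul_eq_integral_mul_condExp hm2 hY1 hIc_int
            (Filter.Eventually.of_forall hIc_le)
            (by rw [hIc2]; exact Filter.Eventually.of_forall hIc_le), hIc2]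
  have hprob : (∫ ω, φ ω * (if D1 ω then (1 : ℝ) else 0) ∂P)
      = (P {ω | D0 ω = false ∧ D1 ω = true}).toReal := by
    rw [integral_congr_ae hweight, integral_condExp hm1, hIc_ind, integral_indicator_one hC]
    rfl
  refine ⟨hmean, hprob, ?_⟩
  have hYc : ∫ ω, Y1 ω * Ic ω ∂P = ∫ ω in {ω | D0 ω = false ∧ D1 ω = true}, Y1 ω ∂P := by
    rw [← integral_indicator hC]
    congr 1
    ext ω
    simp [hIc, Set.indicator]
  rw [hmean, hprob, hYc]
  change ∫ ω, Y1 ω ∂(P[|{ω | D0 ω = false ∧ D1 ω = true}]) = _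
  rw [ProbabilityTheory.cond, integral_smul_measure, ENNReal.toReal_inv, smul_eq_mul,
    div_eq_inv_mul]
end
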